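/- Let L ≤ M ≤ N be natural numbers and let U be an M×N real matrix with U·Uᵀ·U = U and trace(U·Uᵀ) = L. Then for every s ≥ 1 and all equivalence relations π, σ on Fin s each of whose equivalence classes has exactly 2 elements, one has ∑_{i : Fin s → Fin M} ∑_{j : Fin s → Fin N} δ_π(i) δ_σ(j) ∏_{r} U_{i(r), j(r)} = L^{|π ⊔ σ|}, where δ_π(i) = 1 if i is constant on each block of π and δ_π(i) = 0 otherwise, and |π ⊔ σ| is the number of classes of the join of π and σ. -/

import Mathlib

open Matrix
open scoped Classical

/-- A real symmetric idempotent matrix of trace `L` is the projection onto the span of `L`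
orthonormal vectors. -/
theorem exists_mul_transpose_eq_of_isIdempotentElem {n : Type*} [Fintype n]
    {P : Matrix n n ℝ} (hP : P.IsHermitian) (hPP : P * P = P) {L : ℕ} (htr : P.trace = L) :
    ∃ A : Matrix n (Fin L) ℝ, Aᵀ * A = 1 ∧ A * Aᵀ = P := by
  let Q : Matrix n n ℝ := hP.eigenvectorUnitary.1
  have hQQ : Qᵀ * Q = 1 := by
    simpa [star_eq_conjTranspose] using Unitary.coe_star_mul_self hP.eigenvectorUnitary
  have hspec : P = Q * diagonal hP.eigenvalues * Qᵀ := by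
    have h := hP.spectral_theorem
    rw [Unitary.conjStarAlgAut_apply] at h
    simpa [star_eq_conjTranspose, Function.comp_def] using h
  have hdiag : diagonal hP.eigenvalues = Qᵀ * P * Q := by
    calc diagonal hP.eigenvalues
        = (Qᵀ * Q) * diagonal hP.eigenvalues * (Qᵀ * Q) := by simp [hQQ]
      _ = Qᵀ * (Q * diagonal hP.eigenvalues * Qᵀ) * Q := by simp only [Matrix.mul_assoc]
      _ = Qᵀ * P * Q := by rw [← hspec]
  have hQQ' : Q * Qᵀ = 1 := mul_eq_one_comm.mp hQQ
  have hsq : diagonal hP.eigenvalues * diagonal hP.eigenvalues = diagonal hP.eigenvalues := by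
    calc diagonal hP.eigenvalues * diagonal hP.eigenvalues
        = Qᵀ * (P * (Q * Qᵀ) * P) * Q := by rw [hdiag]; simp only [Matrix.mul_assoc]
      _ = diagonal hP.eigenvalues := by rw [hQQ', Matrix.mul_one, hPP, hdiag]
  have h01 (i : n) : hP.eigenvalues i = if hP.eigenvalues i = 1 then 1 else 0 := by
    have h : hP.eigenvalues i * hP.eigenvalues i = hP.eigenvalues i := by
      simpa using congrFun (congrFun hsq i) i
    split_ifs with h1
    · exact h1
    · by_contra h0
      exact h1 (mul_left_cancel₀ h0 (by rw [h, mul_one]))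
  have hcard : Fintype.card {i // hP.eigenvalues i = 1} = L := by
    have h : P.trace = ∑ i, hP.eigenvalues i := by
      simpa using hP.trace_eq_sum_eigenvalues
    rw [htr, Finset.sum_congr rfl fun i _ => h01 i, Finset.sum_boole] at h
    rw [Fintype.card_subtype]
    exact_mod_cast h.symm
  let e : Fin L ≃ {i // hP.eigenvalues i = 1} := (Fintype.equivFinOfCardEq hcard).symm
  refine ⟨Q.submatrix id fun a => (e a : n), ?_, ?_⟩
  · rw [transpose_submatrix, ← submatrix_mul Qᵀ Q _ _ _ Function.bijective_id, hQQ]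
    exact submatrix_one _ (Subtype.val_injective.comp e.injective)
  · ext x y
    rw [congrFun (congrFun hspec x) y, mul_apply, mul_apply]
    simp only [submatrix_apply, transpose_apply, id, mul_diagonal]
    rw [e.sum_comp fun i : {i // hP.eigenvalues i = 1} => Q x i * Q y i,
      ← Finset.sum_subtype (Finset.univ.filter fun i => hP.eigenvalues i = 1) (by simp)
        fun i => Q x i * Q y i, Finset.sum_filter]
    refine Finset.sum_congr rfl fun i _ => ?_
    split_ifs with h
    · rw [h, mul_one]
    · rw [h01 i, if_neg h, mul_zero, zero_mul]

/-- A partial isometry of rank `L` factors through two isometries from dimension `L`. -/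
theorem exists_isometry_factorization {m n : Type*} [Fintype m] [Fintype n]
    {U : Matrix m n ℝ} (hU : U * Uᵀ * U = U) {L : ℕ} (htr : (U * Uᵀ).trace = L) :
    ∃ (A : Matrix m (Fin L) ℝ) (B : Matrix n (Fin L) ℝ),
      Aᵀ * A = 1 ∧ Bᵀ * B = 1 ∧ U = A * Bᵀ := by
  have hP : (U * Uᵀ).IsHermitian := by
    simpa using isHermitian_mul_conjTranspose_self U
  have hPP : U * Uᵀ * (U * Uᵀ) = U * Uᵀ := by
    rw [← Matrix.mul_assoc, hU]
  obtain ⟨A, hA, hAP⟩ := exists_mul_transpose_eq_of_isIdempotentElem hP hPP htr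
  refine ⟨A, Uᵀ * A, hA, ?_, ?_⟩
  · calc (Uᵀ * A)ᵀ * (Uᵀ * A) = Aᵀ * (U * Uᵀ) * A := by
          simp only [transpose_mul, transpose_transpose, Matrix.mul_assoc]
      _ = (Aᵀ * A) * (Aᵀ * A) := by rw [← hAP]; simp only [Matrix.mul_assoc]
      _ = 1 := by rw [hA, Matrix.mul_one]
  · rw [transpose_mul, transpose_transpose, ← Matrix.mul_assoc, hAP, hU]

/-- Summing over the functions compatible with `τ` is summing over functions on the quotient. -/
theorem sum_ite_le_ker {S α R : Type*} [Fintype S] [DecidableEq S] [Fintype α] [Semiring R]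
    (τ : Setoid S) (F : (S → α) → R) :
    ∑ i : S → α, (if τ ≤ Setoid.ker i then (1 : R) else 0) * F i =
      ∑ q : Quotient τ → α, F fun r => q ⟦r⟧ := by
  simp only [ite_mul, one_mul, zero_mul]
  rw [← Finset.sum_filter, Finset.sum_subtype _ (p := fun i => τ ≤ Setoid.ker i) (by simp),
    ← (Setoid.liftEquiv τ).symm.sum_comp]
  rfl

/-- An isometry carries the vector of a pairing to the vector of the same pairing. -/
theorem sum_ite_le_ker_prod {S α β R : Type*} [Fintype S] [DecidableEq S] [Fintype α]
    [DecidableEq β] [CommRing R] {A : Matrix α β R} (hA : Aᵀ * A = 1) (π : Setoid S)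
    (hπ : ∀ x, Nat.card {y // π.r x y} = 2) (k : S → β) :
    ∑ i : S → α, (if π ≤ Setoid.ker i then (1 : R) else 0) * ∏ r, A (i r) (k r) =
      if π ≤ Setoid.ker k then 1 else 0 := by
  rw [sum_ite_le_ker π fun i => ∏ r, A (i r) (k r)]
  have hfiber (i : Quotient π → α) : ∏ r, A (i ⟦r⟧) (k r) =
      ∏ q, ∏ r with (⟦r⟧ : Quotient π) = q, A (i q) (k r) := by
    rw [← Finset.prod_fiberwise Finset.univ fun r => (⟦r⟧ : Quotient π)]
    refine Finset.prod_congr rfl fun q _ => Finset.prod_congr rfl fun r hr => ?_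
    rw [(Finset.mem_filter.mp hr).2]
  have hblock (q : Quotient π) : ∑ a, ∏ r with (⟦r⟧ : Quotient π) = q, A a (k r) =
      if ∀ x y : S, ⟦x⟧ = q → ⟦y⟧ = q → k x = k y then 1 else 0 := by
    induction q using Quotient.inductionOn with
    | h x =>
    have hcard : (Finset.univ.filter fun r => (⟦r⟧ : Quotient π) = ⟦x⟧).card = 2 := by
      rw [← hπ x, Nat.card_eq_fintype_card, Fintype.card_subtype]
      congr 1
      ext y
      simp only [Finset.mem_filter, Finset.mem_univ, true_and]
      exact Quotient.eq.trans ⟨π.symm, π.symm⟩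
    obtain ⟨y, z, hyz, hset⟩ := Finset.card_eq_two.mp hcard
    have hmem (r : S) : (⟦r⟧ : Quotient π) = ⟦x⟧ ↔ r = y ∨ r = z := by
      simpa using Finset.ext_iff.mp hset r
    rw [hset]
    simp only [Finset.prod_pair hyz, hmem]
    have h : ∑ a, A a (k y) * A a (k z) = if k y = k z then 1 else 0 := by
      simpa [mul_apply, one_apply] using congrFun (congrFun hA (k y)) (k z)
    rw [h]
    congr 1
    grind
  simp only [hfiber]
  rw [← Fintype.prod_sum (fun (q : Quotient π) a => ∏ r with (⟦r⟧ : Quotient π) = q, A a (k r)),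
    Finset.prod_congr rfl fun q _ => hblock q, Finset.prod_boole]
  congr 1
  refine propext ⟨fun h x y hxy => h ⟦x⟧ (Finset.mem_univ _) x y rfl (Quotient.sound (π.symm hxy)),
    fun h q _ x y hx hy => h (Quotient.exact (hx.trans hy.symm))⟩

/-- If `U ∈ O_{MN}^L` (i.e. `U * Uᵀ * U = U` and `trace (U * Uᵀ) = L`), then for
every `s ≥ 1` and all pairings `π, σ` of `Fin s` (equivalence relations with all classes of
size 2) one has
`∑_i ∑_j δ_π(i) δ_σ(j) ∏_r U (i r) (j r) = L ^ |π ⊔ σ|`,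
where `δ_π(i) = 1` iff `i` is constant on each block of `π` (i.e. `π ≤ Setoid.ker i` in
Mathlib's order) and `|π ⊔ σ|` is the number of classes of the join. -/
theorem stmt_15 (L M N : ℕ) (hLM : L ≤ M) (hMN : M ≤ N)
    (U : Matrix (Fin M) (Fin N) ℝ)
    (hU : U * Uᵀ * U = U) (htU : (U * Uᵀ).trace = (L : ℝ))
    (s : ℕ) (hs : 1 ≤ s) (π σ : Setoid (Fin s))
    (hπ : ∀ x, Nat.card {y // π.r x y} = 2)
    (hσ : ∀ x, Nat.card {y // σ.r x y} = 2) :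
    ∑ i : Fin s → Fin M, ∑ j : Fin s → Fin N,
      (if π ≤ Setoid.ker i then (1 : ℝ) else 0) *
        (if σ ≤ Setoid.ker j then (1 : ℝ) else 0) * ∏ r, U (i r) (j r) =
      (L : ℝ) ^ Nat.card (Quotient (π ⊔ σ)) := by
  obtain ⟨A, B, hA, hB, rfl⟩ := exists_isometry_factorization hU htU
  have hexp (i : Fin s → Fin M) (j : Fin s → Fin N) :
      ∏ r, (A * Bᵀ) (i r) (j r) =
        ∑ k : Fin s → Fin L, (∏ r, A (i r) (k r)) * ∏ r, B (j r) (k r) := by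
    simp only [mul_apply, transpose_apply, Fintype.prod_sum, Finset.prod_mul_distrib]
  calc
    _ = ∑ k : Fin s → Fin L,
        (∑ i : Fin s → Fin M, (if π ≤ Setoid.ker i then (1 : ℝ) else 0) * ∏ r, A (i r) (k r)) *
        ∑ j : Fin s → Fin N, (if σ ≤ Setoid.ker j then (1 : ℝ) else 0) * ∏ r, B (j r) (k r) := by
        simp_rw [Finset.sum_mul_sum]
        symm
        rw [Finset.sum_comm]
        refine Finset.sum_congr rfl fun i _ => ?_
        rw [Finset.sum_comm]
        refine Finset.sum_congr rfl fun j _ => ?_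
        rw [hexp, Finset.mul_sum]
        exact Finset.sum_congr rfl fun k _ => by ring
    _ = ∑ k : Fin s → Fin L, (if π ⊔ σ ≤ Setoid.ker k then (1 : ℝ) else 0) * 1 := by
        refine Finset.sum_congr rfl fun k _ => ?_
        rw [sum_ite_le_ker_prod hA π hπ, sum_ite_le_ker_prod hB σ hσ]
        simp only [sup_le_iff, ← ite_and, ite_mul, one_mul, zero_mul, mul_one]
    _ = (L : ℝ) ^ Nat.card (Quotient (π ⊔ σ)) := by
        rw [sum_ite_le_ker (π ⊔ σ) fun _ => (1 : ℝ)]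
        simp [Nat.card_eq_fintype_card]
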